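/- (Proposition 3, first smoothness inequality.) Let α ∈ ℝ^M with α_m ≥ 0 and Σ_m α_m = 1, and let p, p' ∈ ℝ^K have nonnegative entries with Σ_k p_k = Σ_k p'_k = P and β_m·Ξ_m(q) ≤ μ₀ for every m and every q on the segment joining p and p'. Then ‖Σ_{m=1}^M α_m β_m (∇_p Ξ_m(p) − ∇_p Ξ_m(p'))‖_∞ ≤ L₁·‖p − p'‖₁, where L₁ = max_{m,k} (β_m a_m b_m ξBT G_{k,k}/(D_m ln 2 · σ⁴))·(μ₀/(β_m a_m))^{1+1/b_m}·[G_{k,k} + ((b_m+1)ξBT H_m/(D_m ln 2))·(μ₀/(β_m a_m))^{1/b_m}]. -/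

import Mathlib

open Finset

/-- Total number of collected samples (minus A_m) of task m in the asymptotic regime:
Σ_{k∈Y} (ξBT/D_m) log₂(1 + G_kk p_k/σ²). -/
noncomputable def Srate {K : ℕ} (G : Fin K → ℝ) (σ2 ξ B T Dm : ℝ)
    (Y : Finset (Fin K)) (p : Fin K → ℝ) : ℝ :=
  ∑ k ∈ Y, ξ * B * T / Dm * Real.logb 2 (1 + G k * p k / σ2)

/-- Asymptotic classification error Ξ_m(p) of task m. -/
noncomputable def Xi {K : ℕ} (G : Fin K → ℝ) (σ2 ξ B T Dm Am am bm : ℝ)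
    (Y : Finset (Fin K)) (p : Fin K → ℝ) : ℝ :=
  am * (Srate G σ2 ξ B T Dm Y p + Am) ^ (-bm)

/-- Partial derivative ∂Ξ_m/∂p_j (closed form, eq. (24) of the paper). -/
noncomputable def dXi {K : ℕ} (G : Fin K → ℝ) (σ2 ξ B T Dm Am am bm : ℝ)
    (Y : Finset (Fin K)) (p : Fin K → ℝ) (j : Fin K) : ℝ :=
  -(am * bm * (ξ * B * T) * (if j ∈ Y then (1 : ℝ) else 0)
      / (Dm * Real.log 2 * (σ2 / G j + p j)))
    * (Srate G σ2 ξ B T Dm Y p + Am) ^ (-bm - 1)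

/-- The constant H_m = ‖(𝟙_{Y}(1) G_11, …, 𝟙_{Y}(K) G_KK)‖₂. -/
noncomputable def Hconst {K : ℕ} (G : Fin K → ℝ) (Y : Finset (Fin K)) : ℝ :=
  Real.sqrt (∑ j, (if j ∈ Y then G j else 0) ^ 2)

lemma aux_log {x y : ℝ} (hx : 1 ≤ x) (hy : 1 ≤ y) : |Real.log x - Real.log y| ≤ |x - y| := by
  have key : ∀ x y : ℝ, 1 ≤ x → 1 ≤ y → Real.log x - Real.log y ≤ |x - y| := by
    intro x y hx hy
    have hx0 : 0 < x := by linarith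
    have hy0 : 0 < y := by linarith
    rw [← Real.log_div hx0.ne' hy0.ne']
    have h1 := Real.log_le_sub_one_of_pos (div_pos hx0 hy0)
    have h2 : x / y - 1 = (x - y) / y := by field_simp
    have h3 : (x - y) / y ≤ |x - y| / y := by gcongr; exact le_abs_self _
    have h4 : |x - y| / y ≤ |x - y| := div_le_self (abs_nonneg _) hy
    linarith
  rw [abs_le]
  have h1 := key x y hx hy
  have h2 := key y x hy hx
  rw [abs_sub_comm] at h2
  constructor <;> linarith

lemma aux_rpow {s x y c : ℝ} (hs : 0 < s) (hc : 0 < c) (hx : s ≤ x) (hy : s ≤ y) :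
    |x ^ (-c) - y ^ (-c)| ≤ c * s ^ (-c - 1) * |x - y| := by
  have := (convex_Ici s).norm_image_sub_le_of_norm_hasDerivWithin_le
    (f := fun t : ℝ => t ^ (-c)) (f' := fun t => (-c) * t ^ (-c - 1)) (C := c * s ^ (-c - 1))
    (x := y) (y := x) ?_ ?_ hy hx
  · simpa using this
  · intro t ht
    exact (Real.hasDerivAt_rpow_const (Or.inl (lt_of_lt_of_le hs ht).ne')).hasDerivWithinAt
  · intro t ht
    have ht0 : 0 < t := lt_of_lt_of_le hs ht
    rw [Real.norm_eq_abs, abs_mul, abs_neg, abs_of_pos hc, abs_of_pos (Real.rpow_pos_of_pos ht0 _)]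
    exact mul_le_mul_of_nonneg_left (Real.rpow_le_rpow_of_nonpos hs ht (by linarith)) hc.le

lemma aux_inv {g x y : ℝ} (hg : 0 < g) (hx : 0 ≤ x) (hy : 0 ≤ y) :
    |1 / (g + x) - 1 / (g + y)| ≤ (1 / g) ^ 2 * |x - y| := by
  have h1 : 0 < g + x := by linarith
  have h2 : 0 < g + y := by linarith
  have : 1 / (g + x) - 1 / (g + y) = (y - x) * (1 / ((g + x) * (g + y))) := by
    field_simp; ring
  rw [this, abs_mul, abs_sub_comm, mul_comm]
  gcongr
  rw [abs_of_pos (by positivity), one_div_pow]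
  apply one_div_le_one_div_of_le (by positivity)
  nlinarith [mul_nonneg hx hy, mul_nonneg hg.le hx, mul_nonneg hg.le hy]

lemma aux_H {K : ℕ} (G : Fin K → ℝ) (hG : ∀ k, 0 < G k) (Y : Finset (Fin K)) (k : Fin K)
    (hk : k ∈ Y) : G k ≤ Hconst G Y := by
  unfold Hconst
  apply Real.le_sqrt_of_sq_le
  have := Finset.single_le_sum (f := fun j => (if j ∈ Y then G j else 0) ^ 2)
    (fun i _ => sq_nonneg _) (Finset.mem_univ k)
  simpa [hk] using this

lemma aux_S {K : ℕ} (G : Fin K → ℝ) (σ2 ξ B T Dm : ℝ) (Y : Finset (Fin K)) (p p' : Fin K → ℝ)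
    (hG : ∀ k, 0 < G k) (hσ : 0 < σ2) (hξ : 0 < ξ) (hB : 0 < B) (hT : 0 < T) (hD : 0 < Dm)
    (hp : ∀ k, 0 ≤ p k) (hp' : ∀ k, 0 ≤ p' k) :
    |Srate G σ2 ξ B T Dm Y p - Srate G σ2 ξ B T Dm Y p'| ≤
      ξ * B * T / (Dm * Real.log 2) * (Hconst G Y / σ2) * ∑ k, |p k - p' k| := by
  have hl : 0 < Real.log 2 := Real.log_pos (by norm_num)
  unfold Srate
  rw [← Finset.sum_sub_distrib, Finset.mul_sum]
  refine (Finset.abs_sum_le_sum_abs _ _).trans ?_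
  have hH : 0 ≤ Hconst G Y := Real.sqrt_nonneg _
  refine le_trans ?_ (Finset.sum_le_sum_of_subset_of_nonneg (Finset.subset_univ Y)
    (fun i _ _ => by positivity))
  apply Finset.sum_le_sum
  intro k hk
  have e : ξ * B * T / Dm * Real.logb 2 (1 + G k * p k / σ2)
      - ξ * B * T / Dm * Real.logb 2 (1 + G k * p' k / σ2)
      = ξ * B * T / (Dm * Real.log 2) *
        (Real.log (1 + G k * p k / σ2) - Real.log (1 + G k * p' k / σ2)) := by
    unfold Real.logb; field_simp
  rw [e, abs_mul, abs_of_pos (by positivity), mul_assoc (ξ * B * T / (Dm * Real.log 2))]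
  refine mul_le_mul_of_nonneg_left ?_ (by positivity)
  have hGk := hG k
  have h1 : 0 ≤ G k * p k / σ2 := div_nonneg (mul_nonneg hGk.le (hp k)) hσ.le
  have h2 : 0 ≤ G k * p' k / σ2 := div_nonneg (mul_nonneg hGk.le (hp' k)) hσ.le
  refine (aux_log (by linarith) (by linarith)).trans ?_
  have e2 : 1 + G k * p k / σ2 - (1 + G k * p' k / σ2) = G k / σ2 * (p k - p' k) := by
    field_simp; ring
  rw [e2, abs_mul, abs_of_pos (by positivity)]
  gcongr
  exact aux_H G hG Y k hk

lemma aux_low {a b β μ0 S : ℝ} (ha : 0 < a) (hb : 0 < b) (hβ : 1 ≤ β) (hμ0 : 0 < μ0) (hS : 0 < S)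
    (h : β * (a * S ^ (-b)) ≤ μ0) : (μ0 / (β * a)) ^ (-(1 / b)) ≤ S := by
  have hβ0 : 0 < β := by linarith
  have h1 : S ^ (-b) ≤ μ0 / (β * a) := by
    rw [le_div_iff₀ (by positivity)]; linarith
  have h2 := Real.rpow_le_rpow_of_nonpos (Real.rpow_pos_of_pos hS (-b)) h1
    (z := -(1 / b)) (by have : 0 < 1 / b := by positivity
                        linarith)
  rw [← Real.rpow_mul hS.le] at h2
  have e : -b * -(1 / b) = 1 := by field_simp
  rwa [e, Real.rpow_one] at h2

lemma aux_Spos {K : ℕ} (G : Fin K → ℝ) (σ2 ξ B T Dm : ℝ) (Y : Finset (Fin K)) (p : Fin K → ℝ)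
    (hG : ∀ k, 0 < G k) (hσ : 0 < σ2) (hξ : 0 < ξ) (hB : 0 < B) (hT : 0 < T) (hD : 0 < Dm)
    (hp : ∀ k, 0 ≤ p k) : 0 ≤ Srate G σ2 ξ B T Dm Y p := by
  unfold Srate
  apply Finset.sum_nonneg
  intro k _
  have h1 : 0 ≤ G k * p k / σ2 := div_nonneg (mul_nonneg (hG k).le (hp k)) hσ.le
  exact mul_nonneg (by positivity) (Real.logb_nonneg (by norm_num) (by linarith))

lemma aux_task {K : ℕ} (G : Fin K → ℝ) (σ2 ξ B T Dm Am a b β μ0 : ℝ) (Y : Finset (Fin K))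
    (p p' : Fin K → ℝ)
    (hG : ∀ k, 0 < G k) (hσ : 0 < σ2) (hξ : 0 < ξ) (hB : 0 < B) (hT : 0 < T) (hD : 0 < Dm)
    (hA : 0 < Am) (ha : 0 < a) (hb : 0 < b) (hβ : 1 ≤ β) (hμ0 : 0 < μ0)
    (hp : ∀ k, 0 ≤ p k) (hp' : ∀ k, 0 ≤ p' k)
    (h : β * Xi G σ2 ξ B T Dm Am a b Y p ≤ μ0)
    (h' : β * Xi G σ2 ξ B T Dm Am a b Y p' ≤ μ0) (j : Fin K) :
    β * |dXi G σ2 ξ B T Dm Am a b Y p j - dXi G σ2 ξ B T Dm Am a b Y p' j| ≤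
      β * a * b * (ξ * B * T) * G j / (Dm * Real.log 2 * σ2 ^ 2)
              * (μ0 / (β * a)) ^ (1 + 1 / b)
              * (G j + (b + 1) * (ξ * B * T) * Hconst G Y / (Dm * Real.log 2)
                  * (μ0 / (β * a)) ^ (1 / b)) * ∑ k, |p k - p' k| := by
  have hl : 0 < Real.log 2 := Real.log_pos (by norm_num)
  have hβ0 : 0 < β := by linarith
  have hH : 0 ≤ Hconst G Y := Real.sqrt_nonneg _
  have hGj := hG j
  have hN : 0 ≤ ∑ k, |p k - p' k| := Finset.sum_nonneg (fun _ _ => abs_nonneg _)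
  have hr : 0 < μ0 / (β * a) := by positivity
  by_cases hj : j ∈ Y
  swap
  · simp only [dXi, hj, if_false]
    simp only [mul_zero, zero_div, neg_zero, zero_mul, sub_self, abs_zero]
    positivity
  have hS := aux_Spos G σ2 ξ B T Dm Y p hG hσ hξ hB hT hD hp
  have hS' := aux_Spos G σ2 ξ B T Dm Y p' hG hσ hξ hB hT hD hp'
  have hSS := aux_S G σ2 ξ B T Dm Y p p' hG hσ hξ hB hT hD hp hp'
  unfold Xi at h h'
  have hL := aux_low ha hb hβ hμ0 (by linarith) h
  have hL' := aux_low ha hb hβ hμ0 (by linarith) h'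
  simp only [dXi, hj, if_true]
  generalize Srate G σ2 ξ B T Dm Y p = S at *
  generalize Srate G σ2 ξ B T Dm Y p' = S' at *
  generalize Hconst G Y = H at *
  have hNj : |p j - p' j| ≤ ∑ k, |p k - p' k| :=
    Finset.single_le_sum (f := fun k => |p k - p' k|) (fun _ _ => abs_nonneg _) (Finset.mem_univ j)
  generalize ∑ k, |p k - p' k| = N at *
  generalize μ0 / (β * a) = r at *
  have hs : 0 < r ^ (-(1 / b)) := Real.rpow_pos_of_pos hr _
  have hV := aux_rpow (c := b + 1) hs (by linarith) hL hL'
  have e0 : (r ^ (-(1 / b))) ^ (-b - 1) = r ^ (1 + 1 / b) := by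
    rw [← Real.rpow_mul hr.le]; congr 1; field_simp; ring
  have e1 : (r ^ (-(1 / b))) ^ (-(b + 1) - 1) = r ^ (1 + 1 / b) * r ^ (1 / b) := by
    rw [← Real.rpow_mul hr.le, ← Real.rpow_add hr]; congr 1; field_simp; ring
  rw [e1] at hV
  have e2 : -(b + 1) = -b - 1 := by ring
  rw [e2] at hV
  have hV0 : (S + Am) ^ (-b - 1) ≤ r ^ (1 + 1 / b) := by
    rw [← e0]; exact Real.rpow_le_rpow_of_nonpos hs hL (by linarith)
  have hVp : 0 < (S + Am) ^ (-b - 1) := Real.rpow_pos_of_pos (by linarith) _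
  have hR : 0 < r ^ (1 + 1 / b) := Real.rpow_pos_of_pos hr _
  have hR1 : 0 < r ^ (1 / b) := Real.rpow_pos_of_pos hr _
  have hg : 0 < σ2 / G j := by positivity
  have hU := aux_inv hg (hp j) (hp' j)
  have hu' : 1 / (σ2 / G j + p' j) ≤ 1 / (σ2 / G j) :=
    one_div_le_one_div_of_le hg (by linarith [hp' j])
  have hu'0 : 0 < 1 / (σ2 / G j + p' j) := one_div_pos.mpr (by linarith [hp' j])
  have hz : 0 < σ2 / G j + p j := by linarith [hp j]
  have hz' : 0 < σ2 / G j + p' j := by linarith [hp' j]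
  have hSS2 : |S + Am - (S' + Am)| ≤ ξ * B * T / (Dm * Real.log 2) * (H / σ2) * N := by
    rwa [add_sub_add_right_eq_sub]
  have E : ∀ z V : ℝ, -(a * b * (ξ * B * T) * 1 / (Dm * Real.log 2 * z)) * V
      = -(a * b * (ξ * B * T) / (Dm * Real.log 2)) * (1 / z * V) := by
    intro z V
    rw [mul_one, div_mul_eq_div_div, div_eq_mul_one_div _ z]; ring
  rw [E, E, ← mul_sub, abs_mul, abs_neg, abs_of_pos (by positivity)]
  have e3 : 1 / (σ2 / G j) = G j / σ2 := one_div_div _ _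
  rw [e3] at hU hu'
  generalize 1 / (σ2 / G j + p j) = u at *
  generalize 1 / (σ2 / G j + p' j) = u' at *
  generalize (S + Am) ^ (-b - 1) = V at *
  generalize (S' + Am) ^ (-b - 1) = V' at *
  have main : |u * V - u' * V'| ≤ (G j / σ2) ^ 2 * N * r ^ (1 + 1 / b) + G j / σ2 *
      ((b + 1) * (r ^ (1 + 1 / b) * r ^ (1 / b)) *
        (ξ * B * T / (Dm * Real.log 2) * (H / σ2) * N)) := by
    have : u * V - u' * V' = (u - u') * V + u' * (V - V') := by ring
    rw [this]
    refine (abs_add_le _ _).trans ?_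
    rw [abs_mul, abs_mul, abs_of_pos hVp, abs_of_pos hu'0]
    apply add_le_add
    · exact mul_le_mul (hU.trans (by gcongr)) hV0 hVp.le (by positivity)
    · exact mul_le_mul hu' (hV.trans (by gcongr)) (abs_nonneg _) (by positivity)
  calc _ ≤ β * (a * b * (ξ * B * T) / (Dm * Real.log 2) * ((G j / σ2) ^ 2 * N * r ^ (1 + 1 / b)
      + G j / σ2 * ((b + 1) * (r ^ (1 + 1 / b) * r ^ (1 / b)) *
        (ξ * B * T / (Dm * Real.log 2) * (H / σ2) * N)))) := by gcongr
    _ = _ := by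
      generalize r ^ (1 + 1 / b) = R at *
      generalize r ^ (1 / b) = R1 at *
      field_simp

/-- Proposition 3, first smoothness inequality. -/
theorem smoothness_L1 {K M : ℕ} [NeZero K] [NeZero M]
    (G : Fin K → ℝ) (σ2 ξ B T P μ0 : ℝ)
    (Y : Fin M → Finset (Fin K)) (D A a b β : Fin M → ℝ)
    (α : Fin M → ℝ) (p p' : Fin K → ℝ)
    (hG : ∀ k, 0 < G k) (hσ : 0 < σ2) (hξ : 0 < ξ) (hB : 0 < B) (hT : 0 < T)
    (hP : 0 < P) (hμ0 : 0 < μ0)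
    (hY : ∀ m, (Y m).Nonempty) (hD : ∀ m, 0 < D m) (hA : ∀ m, 0 < A m)
    (ha : ∀ m, 0 < a m) (hb : ∀ m, 0 < b m) (hβ : ∀ m, 1 ≤ β m)
    (hα : ∀ m, 0 ≤ α m) (hα1 : ∑ m, α m = 1)
    (hp : ∀ k, 0 ≤ p k) (hp' : ∀ k, 0 ≤ p' k)
    (hpP : ∑ k, p k = P) (hp'P : ∑ k, p' k = P)
    (hseg : ∀ m, ∀ q ∈ segment ℝ p p',
      β m * Xi G σ2 ξ B T (D m) (A m) (a m) (b m) (Y m) q ≤ μ0) :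
    ‖(fun j => ∑ m, α m * β m *
        (dXi G σ2 ξ B T (D m) (A m) (a m) (b m) (Y m) p j
          - dXi G σ2 ξ B T (D m) (A m) (a m) (b m) (Y m) p' j) : Fin K → ℝ)‖
      ≤ (Finset.univ.sup' Finset.univ_nonempty (fun m : Fin M =>
          Finset.univ.sup' Finset.univ_nonempty (fun k : Fin K =>
            β m * a m * b m * (ξ * B * T) * G k / (D m * Real.log 2 * σ2 ^ 2)
              * (μ0 / (β m * a m)) ^ (1 + 1 / b m)
              * (G k + (b m + 1) * (ξ * B * T) * Hconst G (Y m) / (D m * Real.log 2)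
                  * (μ0 / (β m * a m)) ^ (1 / b m)))))
        * ∑ k, |p k - p' k| := by
  have hN : 0 ≤ ∑ k, |p k - p' k| := Finset.sum_nonneg (fun _ _ => abs_nonneg _)
  set F : Fin M → Fin K → ℝ := fun m k =>
    β m * a m * b m * (ξ * B * T) * G k / (D m * Real.log 2 * σ2 ^ 2)
              * (μ0 / (β m * a m)) ^ (1 + 1 / b m)
              * (G k + (b m + 1) * (ξ * B * T) * Hconst G (Y m) / (D m * Real.log 2)
                  * (μ0 / (β m * a m)) ^ (1 / b m)) with hF
  set L := Finset.univ.sup' Finset.univ_nonempty (fun m : Fin M =>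
          Finset.univ.sup' Finset.univ_nonempty (fun k : Fin K => F m k)) with hL
  have hFL : ∀ m k, F m k ≤ L := fun m k =>
    (Finset.le_sup' (fun k => F m k) (Finset.mem_univ k)).trans
      (Finset.le_sup' (fun m : Fin M =>
          Finset.univ.sup' Finset.univ_nonempty (fun k : Fin K => F m k)) (Finset.mem_univ m))
  have key : ∀ m j, β m * |dXi G σ2 ξ B T (D m) (A m) (a m) (b m) (Y m) p j
          - dXi G σ2 ξ B T (D m) (A m) (a m) (b m) (Y m) p' j| ≤ L * ∑ k, |p k - p' k| := by
    intro m j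
    refine (aux_task G σ2 ξ B T (D m) (A m) (a m) (b m) (β m) μ0 (Y m) p p' hG hσ hξ hB hT (hD m)
      (hA m) (ha m) (hb m) (hβ m) hμ0 hp hp' (hseg m p (left_mem_segment ℝ p p'))
      (hseg m p' (right_mem_segment ℝ p p')) j).trans ?_
    exact mul_le_mul_of_nonneg_right (hFL m j) hN
  have hbound : ∀ j, |∑ m, α m * β m * (dXi G σ2 ξ B T (D m) (A m) (a m) (b m) (Y m) p j
          - dXi G σ2 ξ B T (D m) (A m) (a m) (b m) (Y m) p' j)| ≤ L * ∑ k, |p k - p' k| := by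
    intro j
    refine (Finset.abs_sum_le_sum_abs _ _).trans ?_
    calc _ ≤ ∑ m, α m * (L * ∑ k, |p k - p' k|) := by
          apply Finset.sum_le_sum
          intro m _
          have hβ0 : 0 ≤ β m := by linarith [hβ m]
          rw [abs_mul, abs_mul, abs_of_nonneg (hα m), abs_of_nonneg hβ0, mul_assoc]
          exact mul_le_mul_of_nonneg_left (key m j) (hα m)
      _ = _ := by rw [← Finset.sum_mul, hα1, one_mul]
  have h0 : 0 ≤ L * ∑ k, |p k - p' k| := (abs_nonneg _).trans (hbound 0)
  rw [pi_norm_le_iff_of_nonneg h0]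
  intro j
  rw [Real.norm_eq_abs]
  exact hbound j
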